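/- arXiv:1201.4439 — 2 statements merged into one kernel-verified Lean document; each statement's English description precedes it below -/
import Mathlib

section
/- For any n-ary relation R on ℤ × ℕ definable in M_Z there exists a natural number w (called the width of R) such that R(ā) ↔ R(b̄) holds for any two w-indistinguishable vectors ā, b̄ ∈ (ℤ × ℕ)ⁿ. -/
open FirstOrder Language

/-- Language with relation symbols indexed by `ι`, where symbol `i` has arity `ar i`. -/
def multiRelLang {ι : Type} (ar : ι → ℕ) : FirstOrder.Language where
  Functions _ := Empty
  Relations m := { i : ι // ar i = m }

/-- The structure on `M` interpreting symbol `i` as the relation `Rels i`. -/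
def multiRelStructure {M : Type*} {ι : Type} {ar : ι → ℕ}
    (Rels : ∀ i, (Fin (ar i) → M) → Prop) : (multiRelLang ar).Structure M where
  funMap f := f.elim
  RelMap r x := Rels r.1 fun j => x (Fin.cast r.2 j)

/-- Language with one relation symbol, of arity `n`. -/
def relLang (n : ℕ) : FirstOrder.Language := multiRelLang (fun _ : Unit => n)

/-- `R` is definable, without parameters, by a first-order formula in the language with a
single relation symbol interpreted as `Q`. -/
def DefinableBy {M : Type*} {n k : ℕ} (Q : (Fin n → M) → Prop)
    (R : (Fin k → M) → Prop) : Prop :=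
  letI : (relLang n).Structure M := multiRelStructure (fun _ : Unit => Q)
  ∃ φ : (relLang n).Formula (Fin k), ∀ v : Fin k → M, R v ↔ φ.Realize v

/-- The difference `a − b` of elements of `ℤ × ℕ` (the support of `M_Z`), an element of
`ℤ ∪ {∞}`: it is `a¹ − b¹` if the two elements are in the same galaxy, `∞` otherwise. -/
def diff (a b : ℤ × ℕ) : WithTop ℤ := if a.2 = b.2 then ((a.1 - b.1 : ℤ) : WithTop ℤ) else ⊤

/-- Absolute value on `ℤ ∪ {∞}`, with `|∞| = ∞`. -/
def wabs : WithTop ℤ → WithTop ℤ := WithTop.map (fun z : ℤ => |z|)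

/-- The successor relation of `M_Z` on `ℤ × ℕ`: `v 1` is the successor of `v 0`. -/
def succRel : (Fin 2 → ℤ × ℕ) → Prop := fun v => v 1 = ((v 0).1 + 1, (v 0).2)

/-- Two vectors in `(ℤ × ℕ)ⁿ` are `m`-indistinguishable if `|aᵢ − aⱼ| < m` or
`|bᵢ − bⱼ| < m` implies `aᵢ − aⱼ = bᵢ − bⱼ`, for all `i, j`. -/
def Indist {n : ℕ} (m : ℕ) (a b : Fin n → ℤ × ℕ) : Prop :=
  ∀ i j : Fin n,
    (wabs (diff (a i) (a j)) < ((m : ℤ) : WithTop ℤ) ∨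
      wabs (diff (b i) (b j)) < ((m : ℤ) : WithTop ℤ)) →
    diff (a i) (a j) = diff (b i) (b j)

/-- Translation along a galaxy: the element at difference `z` from `x`. -/
def galaxyShift (x : ℤ × ℕ) (z : ℤ) : ℤ × ℕ := (x.1 + z, x.2)

theorem eq_galaxyShift_iff {x y : ℤ × ℕ} {z : ℤ} :
    x = galaxyShift y z ↔ x.1 - y.1 = z ∧ x.2 = y.2 := by
  rw [Prod.ext_iff, galaxyShift]
  exact and_congr_left' (by lia)

theorem diff_eq_coe_iff {x y : ℤ × ℕ} {z : ℤ} :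
    diff x y = (z : WithTop ℤ) ↔ x = galaxyShift y z := by
  rw [eq_galaxyShift_iff, diff]
  split_ifs with h
  · rw [WithTop.coe_inj]
    simp [h]
  · simp [h]

/-- Families `a` and `b`, over an arbitrary index type, have the same differences of absolute
value less than `m`. -/
def SameSmallDiffs {ι : Type*} (m : ℕ) (a b : ι → ℤ × ℕ) : Prop :=
  ∀ (i j : ι) (z : ℤ), |z| < m → (a i = galaxyShift (a j) z ↔ b i = galaxyShift (b j) z)

theorem Indist.sameSmallDiffs {n m : ℕ} {a b : Fin n → ℤ × ℕ} (h : Indist m a b) :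
    SameSmallDiffs m a b := by
  intro i j z hz
  have small {x y : ℤ × ℕ} (hxy : diff x y = (z : WithTop ℤ)) :
      wabs (diff x y) < ((m : ℤ) : WithTop ℤ) := by
    rw [hxy]
    exact WithTop.coe_lt_coe.2 hz
  rw [← diff_eq_coe_iff, ← diff_eq_coe_iff]
  exact ⟨fun e => h i j (.inl (small e)) ▸ e, fun e => (h i j (.inr (small e))).trans e⟩

namespace SameSmallDiffs

variable {ι : Type*} {m k : ℕ} {a b : ι → ℤ × ℕ}

theorem symm (h : SameSmallDiffs m a b) : SameSmallDiffs m b a :=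
  fun i j z hz => (h i j z hz).symm

theorem mono (h : SameSmallDiffs m a b) (hk : k ≤ m) : SameSmallDiffs k a b :=
  fun i j z hz => h i j z (hz.trans_le (by exact_mod_cast hk))

/-- The back-and-forth step: a new element on one side is matched by one on the other side, at
the cost of halving the bound on the differences. -/
theorem exists_extend [Finite ι] (h : SameSmallDiffs (2 * m) a b) (c : ℤ × ℕ) :
    ∃ d, ∀ (i : ι) (z : ℤ), |z| < m → (c = galaxyShift (a i) z ↔ d = galaxyShift (b i) z) := by
  by_cases hc : ∃ (i : ι) (z : ℤ), |z| < m ∧ c = galaxyShift (a i) z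
  · obtain ⟨i, y, hy, rfl⟩ := hc
    refine ⟨galaxyShift (b i) y, fun j z hz => ?_⟩
    have := h i j (z - y) (by grind)
    simp only [eq_galaxyShift_iff] at this
    simp only [galaxyShift]
    grind
  · push Not at hc
    obtain ⟨g, hg⟩ := (Set.finite_range fun i => (b i).2).exists_notMem
    refine ⟨(0, g), fun i z hz => iff_of_false (hc i z hz) fun e => hg ⟨i, ?_⟩⟩
    exact (eq_galaxyShift_iff.1 e).2.symm

theorem snoc {α : Type*} {v v' : α → ℤ × ℕ} {xs xs' : Fin k → ℤ × ℕ} {c d : ℤ × ℕ}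
    (h : SameSmallDiffs m (Sum.elim v xs) (Sum.elim v' xs'))
    (hcd : ∀ (i : α ⊕ Fin k) (z : ℤ), |z| < m →
      (c = galaxyShift (Sum.elim v xs i) z ↔ d = galaxyShift (Sum.elim v' xs' i) z)) :
    SameSmallDiffs m (Sum.elim v (Fin.snoc xs c : Fin (k + 1) → ℤ × ℕ))
      (Sum.elim v' (Fin.snoc xs' d : Fin (k + 1) → ℤ × ℕ)) := by
  have cases_index (i : α ⊕ Fin (k + 1)) :
      (∃ j : α ⊕ Fin k, Sum.elim v (Fin.snoc xs c : Fin (k + 1) → ℤ × ℕ) i = Sum.elim v xs j ∧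
        Sum.elim v' (Fin.snoc xs' d : Fin (k + 1) → ℤ × ℕ) i = Sum.elim v' xs' j) ∨
      (Sum.elim v (Fin.snoc xs c : Fin (k + 1) → ℤ × ℕ) i = c ∧
        Sum.elim v' (Fin.snoc xs' d : Fin (k + 1) → ℤ × ℕ) i = d) := by
    rcases i with i | i
    · exact .inl ⟨.inl i, rfl, rfl⟩
    · induction i using Fin.lastCases with
      | last => exact .inr (by simp)
      | cast i => exact .inl ⟨.inr i, by simp⟩
  intro i j z hz
  rcases cases_index i with ⟨i', hi, hi'⟩ | ⟨hi, hi'⟩ <;>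
    rcases cases_index j with ⟨j', hj, hj'⟩ | ⟨hj, hj'⟩ <;> rw [hi, hi', hj, hj']
  · exact h i' j' z hz
  · have := hcd i' (-z) (by rwa [abs_neg])
    simp only [eq_galaxyShift_iff] at this ⊢
    grind
  · exact hcd j' z hz
  · simp only [eq_galaxyShift_iff, sub_self]

end SameSmallDiffs

/-- The structure `M_Z`. -/
instance : (relLang 2).Structure (ℤ × ℕ) := multiRelStructure (fun _ : Unit => succRel)

theorem exists_eq_var {γ : Type*} : ∀ t : (relLang 2).Term γ, ∃ i, t = .var i
  | .var i => ⟨i, rfl⟩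
  | .func f _ => Empty.elim f

/-- Every bounded formula over `M_Z` in finitely many variables has a width. -/
theorem exists_width_boundedFormula {α : Type*} [Finite α] {k : ℕ}
    (φ : (relLang 2).BoundedFormula α k) :
    ∃ w : ℕ, ∀ (v v' : α → ℤ × ℕ) (xs xs' : Fin k → ℤ × ℕ),
      SameSmallDiffs w (Sum.elim v xs) (Sum.elim v' xs') →
        (φ.Realize v xs ↔ φ.Realize v' xs') := by
  induction φ with
  | falsum => exact ⟨0, fun _ _ _ _ _ => Iff.rfl⟩
  | equal s t =>
    obtain ⟨i, rfl⟩ := exists_eq_var s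
    obtain ⟨j, rfl⟩ := exists_eq_var t
    refine ⟨1, fun v v' xs xs' h => ?_⟩
    simpa [BoundedFormula.Realize, galaxyShift] using h i j 0 (by simp)
  | rel R ts =>
    obtain ⟨⟨⟩, rfl⟩ := R
    obtain ⟨i, hi⟩ := exists_eq_var (ts 0)
    obtain ⟨j, hj⟩ := exists_eq_var (ts 1)
    refine ⟨2, fun v v' xs xs' h => ?_⟩
    have realize_iff (u : α → ℤ × ℕ) (ys : Fin _ → ℤ × ℕ) :
        (BoundedFormula.rel (L := relLang 2) ⟨(), rfl⟩ ts).Realize u ys ↔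
          Sum.elim u ys j = galaxyShift (Sum.elim u ys i) 1 := by
      change (ts 1).realize _ = galaxyShift ((ts 0).realize _) 1 ↔ _
      rw [hi, hj, Term.realize_var, Term.realize_var]
    rw [realize_iff, realize_iff]
    exact h j i 1 (by simp)
  | imp φ ψ hφ hψ =>
    obtain ⟨w₁, h₁⟩ := hφ
    obtain ⟨w₂, h₂⟩ := hψ
    refine ⟨max w₁ w₂, fun v v' xs xs' h => ?_⟩
    rw [BoundedFormula.realize_imp, BoundedFormula.realize_imp,
      h₁ _ _ _ _ (h.mono (le_max_left _ _)), h₂ _ _ _ _ (h.mono (le_max_right _ _))]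
  | all φ hφ =>
    obtain ⟨w, hw⟩ := hφ
    have realize_all_of {v v' : α → ℤ × ℕ} {xs xs' : Fin _ → ℤ × ℕ}
        (h : SameSmallDiffs (2 * w) (Sum.elim v xs) (Sum.elim v' xs'))
        (hv : φ.all.Realize v xs) : φ.all.Realize v' xs' := by
      intro c
      obtain ⟨d, hd⟩ := h.symm.exists_extend c
      exact (hw _ _ _ _ ((h.symm.mono (by lia)).snoc hd)).2 (hv d)
    exact ⟨2 * w, fun v v' xs xs' h => ⟨realize_all_of h, realize_all_of h.symm⟩⟩


/-- For any `n`-ary relation `R` on `ℤ × ℕ` definable in `M_Z` there is a natural number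
`w` (the width of `R`) such that `R(ā) ↔ R(b̄)` for any two `w`-indistinguishable vectors
`ā, b̄`. -/
theorem width_exists {n : ℕ} (R : (Fin n → ℤ × ℕ) → Prop) (hR : DefinableBy succRel R) :
    ∃ w : ℕ, ∀ a b : Fin n → ℤ × ℕ, Indist w a b → (R a ↔ R b) := by
  obtain ⟨φ, hφ⟩ := hR
  obtain ⟨w, hw⟩ := exists_width_boundedFormula φ
  refine ⟨w, fun a b hab => ?_⟩
  rw [hφ, hφ]
  refine hw a b _ _ fun i j => ?_
  rcases i with i | i
  · rcases j with j | j
    · exact hab.sameSmallDiffs i j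
    · exact j.elim0
  · exact i.elim0
end

section
/- Let Γ' be a group of permutations of ℤ × ℕ containing all shifts, suppose there exists a nonzero integer regular with respect to Γ', and let d be the greatest common divisor of all integers regular with respect to Γ'. Then K_d = {d} or K_d = {d, −d}. Moreover, if K_d = {d} then K_z = {z} for every integer z that is a multiple of d, and if K_d = {d, −d} then K_z = {z, −z} for every integer z that is a multiple of d. -/
/-- A shift: a bijection of `ℤ × ℕ` preserving all differences. -/
def IsShift (f : Equiv.Perm (ℤ × ℕ)) : Prop := ∀ a b : ℤ × ℕ, diff (f a) (f b) = diff a b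

/-- The set `K_z = {γ(a) − γ(b) : γ ∈ G, a − b = z}` for a set `G` of permutations. -/
def KSet (G : Set (Equiv.Perm (ℤ × ℕ))) (z : WithTop ℤ) : Set (WithTop ℤ) :=
  {w | ∃ γ ∈ G, ∃ a b : ℤ × ℕ, diff a b = z ∧ diff (γ a) (γ b) = w}

/-- An integer `z` is regular with respect to `G` if `K_z` is finite and `∞ ∉ K_z`. -/
def Regular (G : Set (Equiv.Perm (ℤ × ℕ))) (z : ℤ) : Prop :=
  (KSet G ((z : ℤ) : WithTop ℤ)).Finite ∧ ⊤ ∉ KSet G ((z : ℤ) : WithTop ℤ)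

/-- The translate of a point of `ℤ × ℕ` by an integer inside its galaxy. -/
def moveBy (b : ℤ × ℕ) (z : ℤ) : ℤ × ℕ := (b.1 + z, b.2)

lemma moveBy_moveBy (b : ℤ × ℕ) (y z : ℤ) :
    moveBy (moveBy b y) z = moveBy b (y + z) := by
  simp [moveBy, add_assoc]

lemma moveBy_injective (b : ℤ × ℕ) : Function.Injective (moveBy b) := by
  intro y z h
  simpa [moveBy] using h

lemma diff_eq_coe_iff_s14 {a b : ℤ × ℕ} {z : ℤ} :
    diff a b = (z : WithTop ℤ) ↔ a = moveBy b z := by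
  unfold diff moveBy
  split_ifs with h
  · rw [WithTop.coe_inj, Prod.ext_iff]
    simp only [h, and_true]
    omega
  · simp [Prod.ext_iff, h]

lemma exists_shift (b c : ℤ × ℕ) :
    ∃ f : Equiv.Perm (ℤ × ℕ), IsShift f ∧ ∀ z, f (moveBy b z) = moveBy c z := by
  refine ⟨Equiv.prodCongr (Equiv.addRight (c.1 - b.1)) (Equiv.swap b.2 c.2), ?_, ?_⟩
  · intro x y
    simp [diff]
  · intro z
    simp [moveBy]
    ring

section Regularity

variable {Γ' : Subgroup (Equiv.Perm (ℤ × ℕ))}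

lemma coe_mem_KSet_iff {z w : ℤ} :
    (w : WithTop ℤ) ∈ KSet (Γ' : Set (Equiv.Perm (ℤ × ℕ))) z ↔
      ∃ γ ∈ Γ', ∃ b, γ (moveBy b z) = moveBy (γ b) w := by
  constructor
  · rintro ⟨γ, hγ, a, b, hab, h⟩
    rw [diff_eq_coe_iff_s14] at hab h
    exact ⟨γ, hγ, b, hab ▸ h⟩
  · rintro ⟨γ, hγ, b, h⟩
    exact ⟨γ, hγ, _, b, diff_eq_coe_iff_s14.2 rfl, diff_eq_coe_iff_s14.2 h⟩

lemma self_mem_KSet (z : ℤ) :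
    (z : WithTop ℤ) ∈ KSet (Γ' : Set (Equiv.Perm (ℤ × ℕ))) z :=
  coe_mem_KSet_iff.2 ⟨1, Γ'.one_mem, (0, 0), rfl⟩

lemma mem_KSet_symm {z w : ℤ}
    (h : (w : WithTop ℤ) ∈ KSet (Γ' : Set (Equiv.Perm (ℤ × ℕ))) z) :
    (z : WithTop ℤ) ∈ KSet (Γ' : Set (Equiv.Perm (ℤ × ℕ))) w := by
  obtain ⟨γ, hγ, b, h⟩ := coe_mem_KSet_iff.1 h
  refine coe_mem_KSet_iff.2 ⟨γ⁻¹, Γ'.inv_mem hγ, γ b, ?_⟩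
  simp [← h]

lemma neg_mem_KSet_neg {z w : ℤ}
    (h : (w : WithTop ℤ) ∈ KSet (Γ' : Set (Equiv.Perm (ℤ × ℕ))) z) :
    ((-w : ℤ) : WithTop ℤ) ∈ KSet (Γ' : Set (Equiv.Perm (ℤ × ℕ))) (-z : ℤ) := by
  obtain ⟨γ, hγ, b, h⟩ := coe_mem_KSet_iff.1 h
  refine coe_mem_KSet_iff.2 ⟨γ, hγ, moveBy b z, ?_⟩
  rw [h, moveBy_moveBy, moveBy_moveBy]
  simp [moveBy]

lemma KSet_subset_of_mem (hΓ : ∀ f : Equiv.Perm (ℤ × ℕ), IsShift f → f ∈ Γ') {z w : ℤ}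
    (h : (w : WithTop ℤ) ∈ KSet (Γ' : Set (Equiv.Perm (ℤ × ℕ))) z) :
    KSet (Γ' : Set (Equiv.Perm (ℤ × ℕ))) w ⊆ KSet (Γ' : Set (Equiv.Perm (ℤ × ℕ))) z := by
  rintro v ⟨δ, hδ, a, c, hac, rfl⟩
  obtain ⟨γ, hγ, b, h⟩ := coe_mem_KSet_iff.1 h
  obtain ⟨σ, hσ, hσc⟩ := exists_shift (γ b) c
  rw [diff_eq_coe_iff_s14] at hac
  have hc : σ (γ b) = c := by simpa [moveBy] using hσc 0
  refine ⟨δ * σ * γ, Γ'.mul_mem (Γ'.mul_mem hδ (hΓ σ hσ)) hγ, moveBy b z, b,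
    diff_eq_coe_iff_s14.2 rfl, ?_⟩
  simp [h, hσc, hc, hac]

lemma Regular.exists_moveBy {z : ℤ} (h : Regular (Γ' : Set (Equiv.Perm (ℤ × ℕ))) z)
    {γ : Equiv.Perm (ℤ × ℕ)} (hγ : γ ∈ Γ') (b : ℤ × ℕ) :
    ∃ w : ℤ, (w : WithTop ℤ) ∈ KSet (Γ' : Set (Equiv.Perm (ℤ × ℕ))) z ∧
      γ (moveBy b z) = moveBy (γ b) w := by
  have hmem : diff (γ (moveBy b z)) (γ b) ∈ KSet (Γ' : Set (Equiv.Perm (ℤ × ℕ))) z :=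
    ⟨γ, hγ, _, b, diff_eq_coe_iff_s14.2 rfl, rfl⟩
  obtain ⟨w, hw⟩ := WithTop.ne_top_iff_exists.1 fun e => h.2 (e ▸ hmem)
  exact ⟨w, hw ▸ hmem, diff_eq_coe_iff_s14.1 hw.symm⟩

lemma Regular.exists_coe {z : ℤ} (h : Regular (Γ' : Set (Equiv.Perm (ℤ × ℕ))) z)
    {v : WithTop ℤ} (hv : v ∈ KSet (Γ' : Set (Equiv.Perm (ℤ × ℕ))) z) :
    ∃ w : ℤ, (w : WithTop ℤ) = v :=
  WithTop.ne_top_iff_exists.1 fun e => h.2 (e ▸ hv)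

lemma regular_of_subset {z : ℤ} {s : Set ℤ} (hs : s.Finite)
    (h : KSet (Γ' : Set (Equiv.Perm (ℤ × ℕ))) z ⊆ WithTop.some '' s) :
    Regular (Γ' : Set (Equiv.Perm (ℤ × ℕ))) z := by
  refine ⟨(hs.image _).subset h, fun ht => ?_⟩
  obtain ⟨x, -, hx⟩ := h ht
  exact WithTop.coe_ne_top hx

lemma Regular.of_mem (hΓ : ∀ f : Equiv.Perm (ℤ × ℕ), IsShift f → f ∈ Γ') {z w : ℤ}
    (hz : Regular (Γ' : Set (Equiv.Perm (ℤ × ℕ))) z)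
    (h : (w : WithTop ℤ) ∈ KSet (Γ' : Set (Equiv.Perm (ℤ × ℕ))) z) :
    Regular (Γ' : Set (Equiv.Perm (ℤ × ℕ))) w :=
  ⟨hz.1.subset (KSet_subset_of_mem hΓ h), fun ht => hz.2 (KSet_subset_of_mem hΓ h ht)⟩

lemma Regular.finite_coe_preimage {z : ℤ} (h : Regular (Γ' : Set (Equiv.Perm (ℤ × ℕ))) z) :
    {w : ℤ | (w : WithTop ℤ) ∈ KSet (Γ' : Set (Equiv.Perm (ℤ × ℕ))) z}.Finite :=
  h.1.preimage WithTop.coe_injective.injOn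

lemma regular_zero : Regular (Γ' : Set (Equiv.Perm (ℤ × ℕ))) 0 := by
  refine regular_of_subset (Set.finite_singleton 0) ?_
  rintro _ ⟨γ, -, a, b, hab, rfl⟩
  rw [diff_eq_coe_iff_s14] at hab
  refine ⟨0, rfl, (diff_eq_coe_iff_s14.2 ?_).symm⟩
  simp [hab, moveBy]

lemma Regular.add {y z : ℤ} (hy : Regular (Γ' : Set (Equiv.Perm (ℤ × ℕ))) y)
    (hz : Regular (Γ' : Set (Equiv.Perm (ℤ × ℕ))) z) :
    Regular (Γ' : Set (Equiv.Perm (ℤ × ℕ))) (y + z) := by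
  refine regular_of_subset (hy.finite_coe_preimage.image2 (· + ·) hz.finite_coe_preimage) ?_
  rintro _ ⟨γ, hγ, a, b, hab, rfl⟩
  rw [diff_eq_coe_iff_s14] at hab
  obtain ⟨v, hv, hv'⟩ := hy.exists_moveBy hγ b
  obtain ⟨w, hw, hw'⟩ := hz.exists_moveBy hγ (moveBy b y)
  refine ⟨v + w, ⟨v, hv, w, hw, rfl⟩, (diff_eq_coe_iff_s14.2 ?_).symm⟩
  rw [hab, ← moveBy_moveBy, hw', hv', moveBy_moveBy]

lemma Regular.neg {z : ℤ} (hz : Regular (Γ' : Set (Equiv.Perm (ℤ × ℕ))) z) :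
    Regular (Γ' : Set (Equiv.Perm (ℤ × ℕ))) (-z) := by
  refine regular_of_subset (hz.finite_coe_preimage.image Neg.neg) ?_
  rintro _ ⟨γ, hγ, a, b, hab, rfl⟩
  rw [diff_eq_coe_iff_s14] at hab
  obtain ⟨v, hv, hv'⟩ := hz.exists_moveBy hγ a
  refine ⟨-v, ⟨v, hv, rfl⟩, (diff_eq_coe_iff_s14.2 ?_).symm⟩
  have hb : moveBy a z = b := by rw [hab, moveBy_moveBy]; simp [moveBy]
  rw [hb] at hv'
  rw [hv', moveBy_moveBy]
  simp [moveBy]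

/-- The regular integers, as a subgroup of `ℤ`. -/
def regularSubgroup (Γ' : Subgroup (Equiv.Perm (ℤ × ℕ))) : AddSubgroup ℤ where
  carrier := {z | Regular (Γ' : Set (Equiv.Perm (ℤ × ℕ))) z}
  add_mem' := Regular.add
  zero_mem' := regular_zero
  neg_mem' := Regular.neg

/-- The coefficients of the powers of `∑ s ∈ S, X ^ s`, with `S` the set of integers in
`K_z`, are constant on the sets `K_u`. -/
lemma pow_coeff_eq_of_mem (hΓ : ∀ f : Equiv.Perm (ℤ × ℕ), IsShift f → f ∈ Γ') (R : Type*)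
    [CommSemiring R] {z : ℤ} (hz : Regular (Γ' : Set (Equiv.Perm (ℤ × ℕ))) z) (n : ℕ) {u v : ℤ}
    (huv : (v : WithTop ℤ) ∈ KSet (Γ' : Set (Equiv.Perm (ℤ × ℕ))) u) :
    ((∑ s ∈ hz.finite_coe_preimage.toFinset, AddMonoidAlgebra.single s (1 : R)) ^ n).coeff u =
      ((∑ s ∈ hz.finite_coe_preimage.toFinset, AddMonoidAlgebra.single s (1 : R)) ^ n).coeff v := by
  induction n generalizing u v with
  | zero =>
    obtain ⟨γ, hγ, b, h⟩ := coe_mem_KSet_iff.1 huv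
    have h0 : u = 0 ↔ v = 0 := by
      have hb : moveBy b 0 = b := by simp [moveBy]
      have hc : moveBy (γ b) 0 = γ b := by simp [moveBy]
      constructor
      · rintro rfl
        exact (moveBy_injective _ (by rw [← h, hb, hc])).symm
      · rintro rfl
        rw [hc] at h
        exact moveBy_injective b (by rw [hb, γ.injective h])
    simp only [pow_zero, AddMonoidAlgebra.one_def, AddMonoidAlgebra.coeff_single,
      Finsupp.single_apply, @eq_comm ℤ 0, h0]
  | succ n ih =>
    obtain ⟨γ, hγ, b, h⟩ := coe_mem_KSet_iff.1 huv
    simp only [pow_succ]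
    generalize (∑ s ∈ hz.finite_coe_preimage.toFinset,
      AddMonoidAlgebra.single s (1 : R)) ^ n = P at ih ⊢
    simp only [Finset.mul_sum, AddMonoidAlgebra.coeff_sum, Finsupp.finsetSum_apply]
    have key : ∀ s : ℤ, (s : WithTop ℤ) ∈ KSet (Γ' : Set (Equiv.Perm (ℤ × ℕ))) z →
        ∃ t : ℤ, (t : WithTop ℤ) ∈ KSet (Γ' : Set (Equiv.Perm (ℤ × ℕ))) z ∧
          γ (moveBy b s) = moveBy (γ b) t := fun s hs => by
      obtain ⟨t, ht, e⟩ := (hz.of_mem hΓ hs).exists_moveBy hγ b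
      exact ⟨t, KSet_subset_of_mem hΓ hs ht, e⟩
    choose! i hi hi' using key
    have hinj : Set.InjOn i {s | (s : WithTop ℤ) ∈ KSet (Γ' : Set (Equiv.Perm (ℤ × ℕ))) z} :=
      fun s hs t ht e => moveBy_injective b (γ.injective (by rw [hi' s hs, hi' t ht, e]))
    have himage : hz.finite_coe_preimage.toFinset.image i = hz.finite_coe_preimage.toFinset := by
      refine Finset.eq_of_subset_of_card_le ?_ (Finset.card_image_of_injOn (by simpa using hinj)).ge
      intro t ht
      obtain ⟨s, hs, rfl⟩ := Finset.mem_image.1 ht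
      simpa using hi s (by simpa using hs)
    nth_rw 2 [← himage]
    rw [Finset.sum_image (by simpa using hinj)]
    refine Finset.sum_congr rfl fun s hs => ?_
    have hs : (s : WithTop ℤ) ∈ KSet (Γ' : Set (Equiv.Perm (ℤ × ℕ))) z := by simpa using hs
    simp only [AddMonoidAlgebra.coeff_mul_single_apply, mul_one, ← sub_eq_add_neg]
    refine ih (coe_mem_KSet_iff.2 ⟨γ, hγ, moveBy b s, ?_⟩)
    rw [hi' s hs, moveBy_moveBy, moveBy_moveBy, add_sub_cancel, add_sub_cancel, h]

lemma exists_mem_KSet_of_mem_prime_mul (hΓ : ∀ f : Equiv.Perm (ℤ × ℕ), IsShift f → f ∈ Γ')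
    {p : ℕ} (hp : p.Prime) {z : ℤ} (hz : Regular (Γ' : Set (Equiv.Perm (ℤ × ℕ))) z) {w : ℤ}
    (hw : (w : WithTop ℤ) ∈ KSet (Γ' : Set (Equiv.Perm (ℤ × ℕ))) (p * z : ℤ)) :
    ∃ s : ℤ, (s : WithTop ℤ) ∈ KSet (Γ' : Set (Equiv.Perm (ℤ × ℕ))) z ∧ w = p * s := by
  have : Fact p.Prime := ⟨hp⟩
  have hcoeff := pow_coeff_eq_of_mem hΓ (ZMod p) hz p hw
  have : CharP (AddMonoidAlgebra (ZMod p) ℤ) p :=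
    charP_of_injective_algebraMap (algebraMap (ZMod p) (AddMonoidAlgebra (ZMod p) ℤ)).injective p
  have hp0 : (p : ℤ) ≠ 0 := by exact_mod_cast hp.ne_zero
  simp only [sum_pow_char, AddMonoidAlgebra.single_pow, one_pow, AddMonoidAlgebra.coeff_sum,
    Finsupp.finsetSum_apply, AddMonoidAlgebra.coeff_single, Finsupp.single_apply,
    nsmul_eq_mul, mul_right_inj' hp0] at hcoeff
  by_contra! hne
  rw [Finset.sum_eq_zero (s := hz.finite_coe_preimage.toFinset)
    (f := fun s => if (p : ℤ) * s = w then (1 : ZMod p) else 0)] at hcoeff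
  · rw [Finset.sum_ite_eq' hz.finite_coe_preimage.toFinset z, if_pos] at hcoeff
    · exact one_ne_zero hcoeff
    · simpa using self_mem_KSet z
  · intro s hs
    exact if_neg fun e => hne s (by simpa using hs) e.symm

lemma exists_mem_KSet_of_mem_nat_mul (hΓ : ∀ f : Equiv.Perm (ℤ × ℕ), IsShift f → f ∈ Γ')
    (n : ℕ) {z : ℤ} (hz : Regular (Γ' : Set (Equiv.Perm (ℤ × ℕ))) z) {w : ℤ}
    (hw : (w : WithTop ℤ) ∈ KSet (Γ' : Set (Equiv.Perm (ℤ × ℕ))) (n * z : ℤ)) :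
    ∃ s : ℤ, (s : WithTop ℤ) ∈ KSet (Γ' : Set (Equiv.Perm (ℤ × ℕ))) z ∧ w = n * s := by
  induction n using Nat.recOnMul generalizing z w with
  | zero =>
    obtain ⟨γ, -, b, h⟩ := coe_mem_KSet_iff.1 hw
    refine ⟨z, self_mem_KSet z, ?_⟩
    have h0 : moveBy b ((0 : ℕ) * z) = b := by simp [moveBy]
    rw [h0] at h
    have := moveBy_injective (γ b) (a₁ := 0) (a₂ := w) (by rw [← h]; simp [moveBy])
    simp [← this]
  | one => exact ⟨w, by simpa using hw, by simp⟩
  | prime p hp => exact exists_mem_KSet_of_mem_prime_mul hΓ hp hz hw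
  | mul m n hm hn =>
    have hnz : Regular (Γ' : Set (Equiv.Perm (ℤ × ℕ))) (n * z) := by
      have := (regularSubgroup Γ').nsmul_mem hz n
      rwa [nsmul_eq_mul] at this
    obtain ⟨s, hs, rfl⟩ := hm hnz (w := w) (by rwa [← mul_assoc, ← Nat.cast_mul])
    obtain ⟨t, ht, rfl⟩ := hn hz hs
    exact ⟨t, ht, by push_cast; ring⟩

lemma exists_mem_KSet_of_mem_int_mul (hΓ : ∀ f : Equiv.Perm (ℤ × ℕ), IsShift f → f ∈ Γ')
    (n : ℤ) {z : ℤ} (hz : Regular (Γ' : Set (Equiv.Perm (ℤ × ℕ))) z) {w : ℤ}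
    (hw : (w : WithTop ℤ) ∈ KSet (Γ' : Set (Equiv.Perm (ℤ × ℕ))) (n * z : ℤ)) :
    ∃ s : ℤ, (s : WithTop ℤ) ∈ KSet (Γ' : Set (Equiv.Perm (ℤ × ℕ))) z ∧ w = n * s := by
  obtain ⟨m, rfl | rfl⟩ := n.eq_nat_or_neg
  · exact exists_mem_KSet_of_mem_nat_mul hΓ m hz hw
  · obtain ⟨s, hs, h⟩ := exists_mem_KSet_of_mem_nat_mul hΓ m hz (w := -w)
      (by simpa using neg_mem_KSet_neg hw)
    exact ⟨s, hs, by linarith⟩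

lemma regular_of_gcd {d : ℤ}
    (hgreatest : ∀ e : ℤ, (∀ z : ℤ, Regular (Γ' : Set (Equiv.Perm (ℤ × ℕ))) z → e ∣ z) →
      e ∣ d) : Regular (Γ' : Set (Equiv.Perm (ℤ × ℕ))) d := by
  obtain ⟨g, hg⟩ := Int.subgroup_cyclic (regularSubgroup Γ')
  rw [← AddSubgroup.zmultiples_eq_closure] at hg
  have hgd : g ∣ d := hgreatest g fun z hz => by
    have : z ∈ regularSubgroup Γ' := hz
    rwa [hg, Int.mem_zmultiples_iff] at this
  change d ∈ regularSubgroup Γ'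
  rwa [hg, Int.mem_zmultiples_iff]

end Regularity

/-- Let `Γ'` be a group of permutations of `ℤ × ℕ` containing all shifts, suppose some
nonzero integer is regular with respect to `Γ'`, and let `d` be the greatest common
divisor of all regular integers.  Then `K_d = {d}` or `K_d = {d, −d}`; moreover in the
first case `K_z = {z}` and in the second case `K_z = {z, −z}` for every multiple `z`
of `d`. -/
theorem Kd_structure (Γ' : Subgroup (Equiv.Perm (ℤ × ℕ)))
    (hΓ : ∀ f : Equiv.Perm (ℤ × ℕ), IsShift f → f ∈ Γ')
    (hex : ∃ z : ℤ, z ≠ 0 ∧ Regular (Γ' : Set (Equiv.Perm (ℤ × ℕ))) z)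
    (d : ℤ) (hd0 : 0 ≤ d)
    (hdvd : ∀ z : ℤ, Regular (Γ' : Set (Equiv.Perm (ℤ × ℕ))) z → d ∣ z)
    (hgreatest : ∀ e : ℤ, (∀ z : ℤ, Regular (Γ' : Set (Equiv.Perm (ℤ × ℕ))) z → e ∣ z) →
      e ∣ d) :
    (KSet (Γ' : Set (Equiv.Perm (ℤ × ℕ))) (d : ℤ) = {((d : ℤ) : WithTop ℤ)} ∨
      KSet (Γ' : Set (Equiv.Perm (ℤ × ℕ))) (d : ℤ) =
        {((d : ℤ) : WithTop ℤ), ((-d : ℤ) : WithTop ℤ)}) ∧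
    (KSet (Γ' : Set (Equiv.Perm (ℤ × ℕ))) (d : ℤ) = {((d : ℤ) : WithTop ℤ)} →
      ∀ z : ℤ, d ∣ z →
        KSet (Γ' : Set (Equiv.Perm (ℤ × ℕ))) (z : ℤ) = {((z : ℤ) : WithTop ℤ)}) ∧
    (KSet (Γ' : Set (Equiv.Perm (ℤ × ℕ))) (d : ℤ) =
        {((d : ℤ) : WithTop ℤ), ((-d : ℤ) : WithTop ℤ)} →
      ∀ z : ℤ, d ∣ z →
        KSet (Γ' : Set (Equiv.Perm (ℤ × ℕ))) (z : ℤ) =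
          {((z : ℤ) : WithTop ℤ), ((-z : ℤ) : WithTop ℤ)}) := by
  have hd : Regular (Γ' : Set (Equiv.Perm (ℤ × ℕ))) d := regular_of_gcd hgreatest
  have hd_ne : d ≠ 0 := by
    rintro rfl
    obtain ⟨z, hz, hreg⟩ := hex
    exact hz (zero_dvd_iff.1 (hdvd z hreg))
  have hsub : ∀ w : ℤ, (w : WithTop ℤ) ∈ KSet (Γ' : Set (Equiv.Perm (ℤ × ℕ))) d →
      w = d ∨ w = -d := by
    intro w hw
    obtain ⟨n, rfl⟩ := hdvd w (hd.of_mem hΓ hw)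
    rw [mul_comm] at hw
    obtain ⟨s, hs, h⟩ := exists_mem_KSet_of_mem_int_mul hΓ n hd (mem_KSet_symm hw)
    obtain ⟨m, rfl⟩ := hdvd s (hd.of_mem hΓ hs)
    have hnm : n * m = 1 := mul_left_cancel₀ hd_ne (by linarith)
    rcases Int.eq_one_or_neg_one_of_mul_eq_one hnm with rfl | rfl <;> simp
  refine ⟨?_, ?_, ?_⟩
  · by_cases hneg : ((-d : ℤ) : WithTop ℤ) ∈ KSet (Γ' : Set (Equiv.Perm (ℤ × ℕ))) d
    · right
      refine Set.Subset.antisymm (fun v hv => ?_) ?_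
      · obtain ⟨w, rfl⟩ := hd.exists_coe hv
        rcases hsub w hv with rfl | rfl <;> simp
      · rintro v (rfl | rfl)
        exacts [self_mem_KSet d, hneg]
    · left
      refine Set.Subset.antisymm (fun v hv => ?_) ?_
      · obtain ⟨w, rfl⟩ := hd.exists_coe hv
        rcases hsub w hv with rfl | rfl
        exacts [rfl, (hneg hv).elim]
      · rintro v rfl
        exact self_mem_KSet d
  · rintro hK z ⟨n, rfl⟩
    have hreg : Regular (Γ' : Set (Equiv.Perm (ℤ × ℕ))) (d * n) := by
      have := (regularSubgroup Γ').zsmul_mem hd n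
      rwa [smul_eq_mul, mul_comm] at this
    refine Set.Subset.antisymm (fun v hv => ?_) (Set.singleton_subset_iff.2 (self_mem_KSet _))
    obtain ⟨w, rfl⟩ := hreg.exists_coe hv
    rw [mul_comm] at hv
    obtain ⟨s, hs, rfl⟩ := exists_mem_KSet_of_mem_int_mul hΓ n hd hv
    rw [hK, Set.mem_singleton_iff, WithTop.coe_inj] at hs
    rw [hs, mul_comm]
    rfl
  · rintro hK z ⟨n, rfl⟩
    have hreg (n : ℤ) : Regular (Γ' : Set (Equiv.Perm (ℤ × ℕ))) (n * d) := by
      have := (regularSubgroup Γ').zsmul_mem hd n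
      rwa [smul_eq_mul] at this
    have hmul : ∀ n w : ℤ, (w : WithTop ℤ) ∈ KSet (Γ' : Set (Equiv.Perm (ℤ × ℕ))) (n * d : ℤ) →
        w = n * d ∨ w = -(n * d) := by
      intro n w hw
      obtain ⟨s, hs, rfl⟩ := exists_mem_KSet_of_mem_int_mul hΓ n hd hw
      rcases hsub s hs with rfl | rfl <;> simp
    rw [mul_comm d n]
    refine Set.Subset.antisymm (fun v hv => ?_) ?_
    · obtain ⟨w, rfl⟩ := (hreg n).exists_coe hv
      rcases hmul n w hv with rfl | rfl <;> simp
    · rintro v (rfl | rfl)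
      · exact self_mem_KSet _
      have hneg : ((-d : ℤ) : WithTop ℤ) ∈ KSet (Γ' : Set (Equiv.Perm (ℤ × ℕ))) d := by
        rw [hK]; simp
      obtain ⟨γ, hγ, b, h⟩ := coe_mem_KSet_iff.1 hneg
      obtain ⟨u, hu, hu'⟩ := (hreg n).exists_moveBy hγ b
      obtain ⟨t, ht, ht'⟩ := (hreg (n - 1)).exists_moveBy hγ (moveBy b d)
      have hut : u = -d + t := by
        apply moveBy_injective (γ b)
        rw [← hu', ← moveBy_moveBy, ← h, ← ht', moveBy_moveBy]
        congr 2
        ring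
      rcases hmul n u hu with hu_eq | hu_eq
      · have hnd : n * d = 0 := by
          rcases hmul _ t ht with ht_eq | ht_eq
          · exact (hd_ne (by linarith)).elim
          · linarith
        rw [hnd]
        exact self_mem_KSet 0
      · rwa [← hu_eq]
end
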